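/- Let D ≠ E with D, E ≥ 2, let α be the uniform probability measure on the unit sphere S^{D−1} ⊂ ℝ^D (the normalized (D−1)-dimensional Hausdorff measure on the sphere) and β the uniform probability measure on the unit sphere S^{E−1} ⊂ ℝ^E, with squared Euclidean costs. Then (i) α and β are not isometric: there is no measurable map I : ℝ^D → ℝ^E pushing α onto β with ‖x−x'‖² = ‖I(x)−I(x')‖² for α⊗α-almost every (x,x'); and (ii) there exists ε₀ > 0 such that SGW_ε(α,β) = 0 for every ε > ε₀. -/

import Mathlib

open MeasureTheory Classical

/-- Kullback–Leibler divergence, with value `⊤` when `π` is not absolutely continuous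
with respect to `μ` or the log-likelihood ratio is not integrable. -/
noncomputable def klE {Z : Type*} [MeasurableSpace Z] (π μ : Measure Z) : EReal :=
  if π ≪ μ ∧ Integrable (llr π μ) π then ((∫ z, llr π μ z ∂π : ℝ) : EReal) else ⊤

/-- Entropic Gromov–Wasserstein cost with squared-norm costs. -/
noncomputable def gwE {HX HY : Type*}
    [NormedAddCommGroup HX] [NormedAddCommGroup HY]
    [MeasurableSpace HX] [MeasurableSpace HY]
    (ε : ℝ) (α : Measure HX) (β : Measure HY) : EReal :=
  ⨅ π ∈ {π : Measure (HX × HY) | π.map Prod.fst = α ∧ π.map Prod.snd = β},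
    ((∫ p, ∫ q, (‖p.1 - q.1‖ ^ 2 - ‖p.2 - q.2‖ ^ 2) ^ 2 ∂π ∂π : ℝ) : EReal)
      + (ε : EReal) * klE π (α.prod β)

/-- The uniform probability measure on the unit sphere `S^{D-1} ⊆ ℝ^D`:
the normalized `(D-1)`-dimensional Hausdorff measure on the sphere. -/
noncomputable def uniformSphere (D : ℕ) : Measure (EuclideanSpace ℝ (Fin D)) :=
  (μH[(D : ℝ) - 1] (Metric.sphere (0 : EuclideanSpace ℝ (Fin D)) 1))⁻¹ •
    (μH[(D : ℝ) - 1]).restrict (Metric.sphere (0 : EuclideanSpace ℝ (Fin D)) 1)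

lemma dist_inv_norm_smul_le {V : Type*} [NormedAddCommGroup V] [NormedSpace ℝ V] {x y : V}
    (hx : 1 ≤ ‖x‖) (hy : 1 ≤ ‖y‖) : dist (‖x‖⁻¹ • x) (‖y‖⁻¹ • y) ≤ 2 * dist x y := by
  have hx0 : 0 < ‖x‖ := by linarith
  have hy0 : 0 < ‖y‖ := by linarith
  have hxi : ‖x‖⁻¹ ≤ 1 := inv_le_one_of_one_le₀ hx
  rw [dist_eq_norm, dist_eq_norm]
  have e : ‖x‖⁻¹ • x - ‖y‖⁻¹ • y = ‖x‖⁻¹ • (x - y) + (‖x‖⁻¹ - ‖y‖⁻¹) • y := by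
    rw [smul_sub, sub_smul]; abel
  have h1 : ‖‖x‖⁻¹ • (x - y)‖ ≤ ‖x - y‖ := by
    rw [norm_smul, norm_inv, norm_norm]
    exact mul_le_of_le_one_left (norm_nonneg _) hxi
  have h2 : ‖(‖x‖⁻¹ - ‖y‖⁻¹) • y‖ ≤ ‖x - y‖ := by
    have : (‖x‖⁻¹ - ‖y‖⁻¹) * ‖y‖ = ‖x‖⁻¹ * (‖y‖ - ‖x‖) := by field_simp
    rw [norm_smul, ← norm_norm y, ← norm_mul, norm_norm, this, norm_mul, norm_inv, norm_norm]
    calc ‖x‖⁻¹ * ‖‖y‖ - ‖x‖‖ ≤ ‖‖y‖ - ‖x‖‖ := mul_le_of_le_one_left (norm_nonneg _) hxi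
      _ ≤ ‖x - y‖ := by rw [Real.norm_eq_abs, norm_sub_rev]; exact abs_norm_sub_norm_le y x
  rw [e]
  linarith [norm_add_le (‖x‖⁻¹ • (x - y)) ((‖x‖⁻¹ - ‖y‖⁻¹) • y)]

lemma hausdorffMeasure_sphere_lt_top (n : ℕ) :
    μH[(n : ℝ)] (Metric.sphere (0 : EuclideanSpace ℝ (Fin (n + 1))) 1) < ⊤ := by
  let g : Fin (n + 1) → ℝ → (Fin n → ℝ) → EuclideanSpace ℝ (Fin (n + 1)) :=
    fun i s u => WithLp.toLp 2 (i.insertNth s u)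
  have hg : ∀ i s, LipschitzWith (Fintype.card (Fin (n + 1)) ^ (1 / 2 : ℝ) : NNReal) (g i s) := by
    intro i s
    have h1 := PiLp.lipschitzWith_toLp 2 (fun _ : Fin (n + 1) => ℝ)
    have h2 : LipschitzWith 1 (fun u : Fin n → ℝ => (i.insertNth s u : Fin (n + 1) → ℝ)) := by
      refine LipschitzWith.of_dist_le_mul fun u v => ?_
      rw [NNReal.coe_one, one_mul, dist_pi_le_iff dist_nonneg]
      intro j
      refine Fin.succAboveCases i ?_ (fun k => ?_) j
      · simp
      · simpa using dist_le_pi_dist u v k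
    have := h1.comp h2
    simpa [g, Function.comp_def] using this
  have hnorm : ∀ i (s : ℝ) u, |s| = 1 → 1 ≤ ‖g i s u‖ := by
    intro i s u hs
    have := PiLp.norm_apply_le (g i s u) i
    simpa [g, hs] using this
  obtain ⟨K, hK⟩ : ∃ K : NNReal, ∀ i (s : ℝ), |s| = 1 →
      LipschitzWith K (fun u => ‖g i s u‖⁻¹ • g i s u) := by
    refine ⟨2 * (Fintype.card (Fin (n + 1)) ^ (1 / 2 : ℝ) : NNReal), fun i s hs => ?_⟩
    refine LipschitzWith.of_dist_le_mul fun u v => ?_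
    refine (dist_inv_norm_smul_le (hnorm i s u hs) (hnorm i s v hs)).trans ?_
    have := (hg i s).dist_le_mul u v
    push_cast at this ⊢
    linarith
  let S : Fin (n + 1) × Bool → Set (EuclideanSpace ℝ (Fin (n + 1))) := fun k =>
    (fun u => ‖g k.1 (if k.2 then 1 else -1) u‖⁻¹ • g k.1 (if k.2 then 1 else -1) u) ''
      Metric.closedBall 0 1
  have hS : ∀ k, μH[(n : ℝ)] (S k) < ⊤ := by
    rintro ⟨i, b⟩
    refine ((hK i _ ?_).hausdorffMeasure_image_le (Nat.cast_nonneg n) _).trans_lt ?_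
    · cases b <;> simp
    · refine ENNReal.mul_lt_top ?_ ?_
      · rw [ENNReal.rpow_natCast]; exact ENNReal.pow_lt_top ENNReal.coe_lt_top
      · have := hausdorffMeasure_pi_real (ι := Fin n)
        rw [Fintype.card_fin] at this
        rw [this]
        exact (isCompact_closedBall _ _).measure_lt_top
  have hcov : Metric.sphere (0 : EuclideanSpace ℝ (Fin (n + 1))) 1 ⊆ ⋃ k, S k := by
    intro x hx
    have hx1 : ‖x‖ = 1 := by simpa using hx
    obtain ⟨i, hi⟩ := Finite.exists_max (fun i => |x i|)
    have hpos : 0 < |x i| := by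
      rcases (abs_nonneg (x i)).lt_or_eq with h | h
      · exact h
      · have : x = 0 := by
          ext j
          have := hi j
          rw [← h] at this
          simpa using this
        simp [this] at hx1
    have hg' : g i (x i / |x i|) (fun k => x (i.succAbove k) / |x i|) = |x i|⁻¹ • x := by
      ext j
      refine Fin.succAboveCases i ?_ (fun k => ?_) j <;> simp [g, div_eq_inv_mul]
    refine Set.mem_iUnion.2 ⟨(i, decide (0 < x i)), fun k => x (i.succAbove k) / |x i|, ?_, ?_⟩
    · rw [mem_closedBall_zero_iff, pi_norm_le_iff_of_nonneg zero_le_one]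
      intro k
      rw [Real.norm_eq_abs, abs_div, abs_abs]
      exact div_le_one_of_le₀ (hi _) hpos.le
    · have hs : (if (decide (0 < x i)) = true then (1 : ℝ) else -1) = x i / |x i| := by
        by_cases h : 0 < x i
        · simp [h, abs_of_pos h, h.ne']
        · have h' : x i < 0 := lt_of_le_of_ne (not_lt.1 h) (abs_pos.1 hpos)
          simp [h, abs_of_neg h', h'.ne]
      simp only [hs, hg', norm_smul, hx1]
      rw [smul_smul]
      simp [hpos.ne']
  exact (measure_mono hcov).trans_lt
    ((measure_iUnion_le _).trans_lt (by
      rw [tsum_fintype]; exact ENNReal.sum_lt_top.2 fun k _ => hS k))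

lemma hausdorffMeasure_sphere_pos (n : ℕ) :
    0 < μH[(n : ℝ)] (Metric.sphere (0 : EuclideanSpace ℝ (Fin (n + 1))) 1) := by
  let f : EuclideanSpace ℝ (Fin (n + 1)) → (Fin n → ℝ) := fun x k => x k.succ
  have hf : LipschitzWith 1 f := by
    refine LipschitzWith.of_dist_le_mul fun u v => ?_
    rw [NNReal.coe_one, one_mul, dist_pi_le_iff dist_nonneg]
    intro j
    have := PiLp.norm_apply_le (u - v) j.succ
    simpa [f, dist_eq_norm] using this
  have hsub : {u : Fin n → ℝ | ∑ k, u k ^ 2 < 1} ⊆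
      f '' Metric.sphere (0 : EuclideanSpace ℝ (Fin (n + 1))) 1 := by
    intro u hu
    refine ⟨WithLp.toLp 2 (Fin.cons (√(1 - ∑ k, u k ^ 2)) u), ?_, ?_⟩
    · have hu' : 0 ≤ 1 - ∑ k, u k ^ 2 := by
        have : ∑ k, u k ^ 2 < 1 := hu
        linarith
      simp [EuclideanSpace.norm_eq, Fin.sum_univ_succ, Real.sq_sqrt hu']
    · ext k; simp [f]
  have hle := hf.hausdorffMeasure_image_le (Nat.cast_nonneg n)
    (Metric.sphere (0 : EuclideanSpace ℝ (Fin (n + 1))) 1)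
  have hvol := hausdorffMeasure_pi_real (ι := Fin n)
  rw [Fintype.card_fin] at hvol
  rw [hvol, ENNReal.coe_one, ENNReal.one_rpow, one_mul] at hle
  refine lt_of_lt_of_le ?_ ((measure_mono hsub).trans hle)
  refine IsOpen.measure_pos _ (isOpen_lt (by fun_prop) continuous_const) ⟨0, by simp⟩

lemma sq_integral_le_four_mul_integral_llr {Z : Type*} [MeasurableSpace Z] {π μ : Measure Z}
    [IsProbabilityMeasure π] [IsProbabilityMeasure μ] (hac : π ≪ μ) (hint : Integrable (llr π μ) π)
    {F : Z → ℝ} (hF : Measurable F) (hF1 : ∀ᵐ z ∂μ, |F z| ≤ 1) (hF0 : ∫ z, F z ∂μ = 0) :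
    (∫ z, F z ∂π) ^ 2 ≤ 4 * ∫ z, llr π μ z ∂π := by
  have hF1π : ∀ᵐ z ∂π, |F z| ≤ 1 := hac.ae_le hF1
  have hFμ : Integrable F μ := Integrable.of_bound hF.aestronglyMeasurable 1 hF1
  have hFπ : Integrable F π := Integrable.of_bound hF.aestronglyMeasurable 1 hF1π
  set m := ∫ z, F z ∂π with hm
  have hm1 : |m| ≤ 1 := by
    have := norm_integral_le_of_norm_le_const (f := F) (C := 1) (by simpa using hF1π)
    simpa using this
  set t := m / 2 with ht
  have ht1 : |t| ≤ 1 := by rw [ht, abs_div, abs_two]; linarith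
  have htF : ∀ᵐ z ∂μ, |t * F z| ≤ 1 := by
    filter_upwards [hF1] with z hz
    rw [abs_mul]; exact mul_le_one₀ ht1 (abs_nonneg _) hz
  have hexp : Integrable (fun z => Real.exp (t * F z)) μ := by
    refine Integrable.of_bound (by fun_prop) (Real.exp 1) ?_
    filter_upwards [htF] with z hz
    rw [Real.norm_eq_abs, Real.abs_exp]
    exact Real.exp_le_exp.2 ((le_abs_self _).trans hz)
  have hmgf : ∫ z, Real.exp (t * F z) ∂μ ≤ 1 + t ^ 2 := by
    calc ∫ z, Real.exp (t * F z) ∂μ ≤ ∫ z, (1 + t ^ 2 + t * F z) ∂μ := by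
          refine integral_mono_ae hexp ((integrable_const _).add (hFμ.const_mul t)) ?_
          filter_upwards [htF, hF1] with z hz hz1
          have h1 := (abs_le.1 (Real.abs_exp_sub_one_sub_id_le hz)).2
          have h2 : F z ^ 2 ≤ 1 := (sq_le_one_iff_abs_le_one _).2 hz1
          have h3 : (t * F z) ^ 2 ≤ t ^ 2 := by
            rw [mul_pow]; exact mul_le_of_le_one_right (sq_nonneg t) h2
          linarith
      _ = 1 + t ^ 2 := by
          rw [integral_add (integrable_const _) (hFμ.const_mul t), integral_const_mul, hF0]
          simp
  have hpos : 0 < ∫ z, Real.exp (t * F z) ∂μ := integral_exp_pos hexp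
  have hlog : Real.log (∫ z, Real.exp (t * F z) ∂μ) ≤ t ^ 2 := by
    linarith [Real.log_le_sub_one_of_pos hpos]
  have hprob : IsProbabilityMeasure (μ.tilted fun z => t * F z) := isProbabilityMeasure_tilted hexp
  have hac' : π ≪ μ.tilted fun z => t * F z := hac.trans (absolutelyContinuous_tilted hexp)
  have hgibbs : 0 ≤ ∫ z, llr π (μ.tilted fun z => t * F z) z ∂π := by
    rw [← InformationTheory.toReal_klDiv_of_measure_eq hac' (by simp)]
    exact ENNReal.toReal_nonneg
  rw [integral_llr_tilted_right hac (hFπ.const_mul t) hexp hint, integral_const_mul, ← hm] at hgibbs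
  have hmt : m = 2 * t := by rw [ht]; ring
  rw [hmt] at hgibbs ⊢
  nlinarith

lemma uniformSphere_mass {D : ℕ} (hD : D ≠ 0) :
    μH[(D : ℝ) - 1] (Metric.sphere (0 : EuclideanSpace ℝ (Fin D)) 1) ≠ 0 ∧
      μH[(D : ℝ) - 1] (Metric.sphere (0 : EuclideanSpace ℝ (Fin D)) 1) ≠ ⊤ := by
  obtain ⟨n, rfl⟩ := Nat.exists_eq_succ_of_ne_zero hD
  have : ((n.succ : ℕ) : ℝ) - 1 = n := by push_cast; ring
  rw [this]
  exact ⟨(hausdorffMeasure_sphere_pos n).ne', (hausdorffMeasure_sphere_lt_top n).ne⟩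

lemma isProbabilityMeasure_uniformSphere {D : ℕ} (hD : D ≠ 0) :
    IsProbabilityMeasure (uniformSphere D) := by
  obtain ⟨h0, htop⟩ := uniformSphere_mass hD
  exact ⟨by simp [uniformSphere, ENNReal.inv_mul_cancel h0 htop]⟩

lemma norm_eq_one_ae_uniformSphere (D : ℕ) : ∀ᵐ x ∂uniformSphere D, ‖x‖ = 1 := by
  refine Measure.ae_smul_measure ?_ _
  filter_upwards [ae_restrict_mem Metric.isClosed_sphere.measurableSet] with x hx
  simpa using hx

lemma measurePreserving_uniformSphere {D : ℕ}
    (e : EuclideanSpace ℝ (Fin D) ≃ₗᵢ[ℝ] EuclideanSpace ℝ (Fin D)) :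
    MeasurePreserving e (uniformSphere D) (uniformSphere D) := by
  have h := (e.toIsometryEquiv.measurePreserving_hausdorffMeasure ((D : ℝ) - 1)).restrict_preimage
    (Metric.isClosed_sphere (x := (0 : EuclideanSpace ℝ (Fin D))) (ε := 1)).measurableSet
  have hpre : e.toIsometryEquiv ⁻¹' Metric.sphere (0 : EuclideanSpace ℝ (Fin D)) 1 =
      Metric.sphere 0 1 := by
    ext x; simp
  rw [hpre] at h
  exact h.smul_measure _

lemma integral_comp_uniformSphere {D : ℕ}
    (e : EuclideanSpace ℝ (Fin D) ≃ₗᵢ[ℝ] EuclideanSpace ℝ (Fin D))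
    (f : EuclideanSpace ℝ (Fin D) → ℝ) :
    ∫ x, f (e x) ∂uniformSphere D = ∫ x, f x ∂uniformSphere D :=
  (measurePreserving_uniformSphere e).integral_comp e.toHomeomorph.measurableEmbedding f

lemma integral_apply_uniformSphere {D : ℕ} (i : Fin D) : ∫ x, x i ∂uniformSphere D = 0 := by
  have h := integral_comp_uniformSphere (LinearIsometryEquiv.neg ℝ) (fun x => x i)
  simp only [LinearIsometryEquiv.coe_neg, PiLp.neg_apply, integral_neg] at h
  linarith

lemma integral_apply_mul_apply_uniformSphere {D : ℕ} {i j : Fin D} (hij : i ≠ j) :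
    ∫ x, x i * x j ∂uniformSphere D = 0 := by
  have h := integral_comp_uniformSphere (LinearIsometryEquiv.piLpCongrRight 2 fun k =>
    if k = i then LinearIsometryEquiv.neg ℝ else LinearIsometryEquiv.refl ℝ ℝ)
    (fun x => x i * x j)
  simp [hij.symm, integral_neg] at h
  linarith

lemma abs_apply_le_one {D : ℕ} {x : EuclideanSpace ℝ (Fin D)} (hx : ‖x‖ = 1) (i : Fin D) :
    |x i| ≤ 1 := by
  simpa [hx] using PiLp.norm_apply_le x i

lemma integral_apply_sq_uniformSphere {D : ℕ} (i : Fin D) :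
    ∫ x, x i * x i ∂uniformSphere D = (D : ℝ)⁻¹ := by
  have hD : D ≠ 0 := by rintro rfl; exact i.elim0
  have := isProbabilityMeasure_uniformSphere hD
  have hint (j : Fin D) : Integrable (fun x => x j * x j) (uniformSphere D) := by
    refine Integrable.of_bound (by fun_prop) 1 ?_
    filter_upwards [norm_eq_one_ae_uniformSphere D] with x hx
    rw [norm_mul]
    exact mul_le_one₀ (abs_apply_le_one hx j) (norm_nonneg _) (abs_apply_le_one hx j)
  have hsymm (j : Fin D) : ∫ x, x j * x j ∂uniformSphere D = ∫ x, x i * x i ∂uniformSphere D := by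
    have h := integral_comp_uniformSphere
      (LinearIsometryEquiv.piLpCongrLeft 2 ℝ ℝ (Equiv.swap i j)) (fun x => x i * x i)
    simpa [LinearIsometryEquiv.piLpCongrLeft_apply, Equiv.piCongrLeft'] using h
  have hsum : ∑ j, ∫ x, x j * x j ∂uniformSphere D = 1 := by
    rw [← integral_finsetSum _ fun j _ => hint j]
    have h : ∀ᵐ x ∂uniformSphere D, ∑ j, x j * x j = 1 := by
      filter_upwards [norm_eq_one_ae_uniformSphere D] with x hx
      have := EuclideanSpace.real_norm_sq_eq x
      rw [hx] at this
      simpa [sq] using this.symm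
    rw [integral_congr_ae h]
    simp
  simp only [hsymm, Finset.sum_const, Finset.card_univ, Fintype.card_fin, nsmul_eq_mul] at hsum
  exact eq_inv_of_mul_eq_one_right hsum

lemma sum_sq_integral_apply_mul_apply_uniformSphere {D : ℕ} (hD : D ≠ 0) :
    ∑ k : Fin D × Fin D, (∫ x, x k.1 * x k.2 ∂uniformSphere D) ^ 2 = (D : ℝ)⁻¹ := by
  have h (i j : Fin D) : (∫ x, x i * x j ∂uniformSphere D) ^ 2 =
      if i = j then ((D : ℝ)⁻¹) ^ 2 else 0 := by
    split_ifs with hij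
    · rw [← hij, integral_apply_sq_uniformSphere]
    · rw [integral_apply_mul_apply_uniformSphere hij]; simp
  have hD' : (D : ℝ) ≠ 0 := Nat.cast_ne_zero.2 hD
  rw [Fintype.sum_prod_type]
  simp only [h, Finset.sum_ite_eq, Finset.mem_univ, if_true, Finset.sum_const, Finset.card_univ,
    Fintype.card_fin, nsmul_eq_mul]
  field_simp

lemma integral_integral_sum_mul {Z ι : Type*} [MeasurableSpace Z] [Fintype ι] {π : Measure Z}
    (c : ι → ℝ) {f : ι → Z → ℝ} (hf : ∀ a, Integrable (f a) π) :
    ∫ p, ∫ q, ∑ a, c a * (f a p * f a q) ∂π ∂π = ∑ a, c a * (∫ p, f a p ∂π) ^ 2 := by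
  have h (p : Z) : ∫ q, ∑ a, c a * (f a p * f a q) ∂π = ∑ a, c a * (f a p * ∫ q, f a q ∂π) := by
    rw [integral_finsetSum _ fun a _ => ((hf a).const_mul _).const_mul _]
    simp only [integral_const_mul]
  simp only [h]
  rw [integral_finsetSum _ fun a _ => ((hf a).mul_const _).const_mul _]
  simp only [integral_const_mul, integral_mul_const, sq]

lemma sum_mul_sum_mul {m n : Type*} [Fintype m] [Fintype n] (u u' : m → ℝ) (v v' : n → ℝ) :
    (∑ i, u i * u' i) * (∑ j, v j * v' j) =
      ∑ k : m × n, (u k.1 * v k.2) * (u' k.1 * v' k.2) := by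
  rw [Finset.sum_mul_sum, Fintype.sum_prod_type]
  refine Finset.sum_congr rfl fun i _ => Finset.sum_congr rfl fun j _ => ?_
  ring

lemma inner_eq_sum_mul {D : ℕ} (x y : EuclideanSpace ℝ (Fin D)) :
    inner ℝ x y = ∑ i, x i * y i := by
  simp [PiLp.inner_apply, mul_comm]

lemma norm_sub_sq_of_norm_eq_one {D : ℕ} {x y : EuclideanSpace ℝ (Fin D)} (hx : ‖x‖ = 1)
    (hy : ‖y‖ = 1) : ‖x - y‖ ^ 2 = 2 - 2 * ∑ i, x i * y i := by
  rw [norm_sub_sq_real, hx, hy, inner_eq_sum_mul]; ring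

lemma integrable_mul_of_norm_eq_one {Z : Type*} [MeasurableSpace Z] {π : Measure Z}
    [IsFiniteMeasure π] {D E : ℕ} {f : Z → EuclideanSpace ℝ (Fin D)}
    {g : Z → EuclideanSpace ℝ (Fin E)} (hf : Measurable f) (hg : Measurable g)
    (hf1 : ∀ᵐ z ∂π, ‖f z‖ = 1) (hg1 : ∀ᵐ z ∂π, ‖g z‖ = 1) (i : Fin D) (j : Fin E) :
    Integrable (fun z => f z i * g z j) π := by
  refine Integrable.of_bound (by fun_prop) 1 ?_
  filter_upwards [hf1, hg1] with z hz hz'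
  rw [norm_mul]
  exact mul_le_one₀ (abs_apply_le_one hz i) (norm_nonneg _) (abs_apply_le_one hz' j)

lemma integral_integral_sq_sub_eq {D E : ℕ}
    {π : Measure (EuclideanSpace ℝ (Fin D) × EuclideanSpace ℝ (Fin E))} [IsFiniteMeasure π]
    (h1 : ∀ᵐ p ∂π, ‖p.1‖ = 1) (h2 : ∀ᵐ p ∂π, ‖p.2‖ = 1) :
    ∫ p, ∫ q, (‖p.1 - q.1‖ ^ 2 - ‖p.2 - q.2‖ ^ 2) ^ 2 ∂π ∂π =
      4 * ∑ k : Fin D × Fin D, (∫ p, p.1 k.1 * p.1 k.2 ∂π) ^ 2 +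
      4 * ∑ k : Fin E × Fin E, (∫ p, p.2 k.1 * p.2 k.2 ∂π) ^ 2 -
      8 * ∑ k : Fin D × Fin E, (∫ p, p.1 k.1 * p.2 k.2 ∂π) ^ 2 := by
  let c : (Fin D × Fin D) ⊕ (Fin E × Fin E) ⊕ (Fin D × Fin E) → ℝ :=
    Sum.elim (fun _ => 4) (Sum.elim (fun _ => 4) fun _ => -8)
  let f : (Fin D × Fin D) ⊕ (Fin E × Fin E) ⊕ (Fin D × Fin E) →
      EuclideanSpace ℝ (Fin D) × EuclideanSpace ℝ (Fin E) → ℝ :=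
    Sum.elim (fun k p => p.1 k.1 * p.1 k.2)
      (Sum.elim (fun k p => p.2 k.1 * p.2 k.2) fun k p => p.1 k.1 * p.2 k.2)
  have hf : ∀ a, Integrable (f a) π := by
    rintro (k | k | k)
    · exact integrable_mul_of_norm_eq_one measurable_fst measurable_fst h1 h1 _ _
    · exact integrable_mul_of_norm_eq_one measurable_snd measurable_snd h2 h2 _ _
    · exact integrable_mul_of_norm_eq_one measurable_fst measurable_snd h1 h2 _ _
  have key : ∫ p, ∫ q, (‖p.1 - q.1‖ ^ 2 - ‖p.2 - q.2‖ ^ 2) ^ 2 ∂π ∂π =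
      ∫ p, ∫ q, ∑ a, c a * (f a p * f a q) ∂π ∂π := by
    refine integral_congr_ae ?_
    filter_upwards [h1, h2] with p hp1 hp2
    refine integral_congr_ae ?_
    filter_upwards [h1, h2] with q hq1 hq2
    simp only [Fintype.sum_sum_type, c, f, Sum.elim_inl, Sum.elim_inr, ← Finset.mul_sum,
      ← sum_mul_sum_mul, norm_sub_sq_of_norm_eq_one hp1 hq1, norm_sub_sq_of_norm_eq_one hp2 hq2]
    ring
  rw [key, integral_integral_sum_mul c hf]
  simp only [Fintype.sum_sum_type, c, f, Sum.elim_inl, Sum.elim_inr, ← Finset.mul_sum]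
  ring

lemma integral_integral_sq_sub_uniformSphere {D E : ℕ} (hD : D ≠ 0) (hE : E ≠ 0)
    {π : Measure (EuclideanSpace ℝ (Fin D) × EuclideanSpace ℝ (Fin E))} [IsFiniteMeasure π]
    (hα : π.map Prod.fst = uniformSphere D) (hβ : π.map Prod.snd = uniformSphere E) :
    ∫ p, ∫ q, (‖p.1 - q.1‖ ^ 2 - ‖p.2 - q.2‖ ^ 2) ^ 2 ∂π ∂π =
      4 * (D : ℝ)⁻¹ + 4 * (E : ℝ)⁻¹ -
      8 * ∑ k : Fin D × Fin E, (∫ p, p.1 k.1 * p.2 k.2 ∂π) ^ 2 := by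
  have h1 : ∀ᵐ p ∂π, ‖p.1‖ = 1 :=
    ae_of_ae_map measurable_fst.aemeasurable (hα ▸ norm_eq_one_ae_uniformSphere D)
  have h2 : ∀ᵐ p ∂π, ‖p.2‖ = 1 :=
    ae_of_ae_map measurable_snd.aemeasurable (hβ ▸ norm_eq_one_ae_uniformSphere E)
  rw [integral_integral_sq_sub_eq h1 h2, ← sum_sq_integral_apply_mul_apply_uniformSphere hD,
    ← sum_sq_integral_apply_mul_apply_uniformSphere hE]
  have e1 (k : Fin D × Fin D) :
      ∫ x, x k.1 * x k.2 ∂uniformSphere D = ∫ p, p.1 k.1 * p.1 k.2 ∂π := by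
    rw [← hα, integral_map measurable_fst.aemeasurable (by fun_prop)]
  have e2 (k : Fin E × Fin E) :
      ∫ x, x k.1 * x k.2 ∂uniformSphere E = ∫ p, p.2 k.1 * p.2 k.2 ∂π := by
    rw [← hβ, integral_map measurable_snd.aemeasurable (by fun_prop)]
  simp only [e1, e2]

lemma integral_prod_uniformSphere {D E : ℕ} (i : Fin D) (j : Fin E) :
    ∫ p, p.1 i * p.2 j ∂(uniformSphere D).prod (uniformSphere E) = 0 := by
  have hD : D ≠ 0 := by rintro rfl; exact i.elim0
  have hE : E ≠ 0 := by rintro rfl; exact j.elim0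
  have := isProbabilityMeasure_uniformSphere hD
  have := isProbabilityMeasure_uniformSphere hE
  rw [integral_prod_mul (fun x : EuclideanSpace ℝ (Fin D) => x i)
    (fun y : EuclideanSpace ℝ (Fin E) => y j), integral_apply_uniformSphere, zero_mul]

lemma klE_self {Z : Type*} [MeasurableSpace Z] (μ : Measure Z) [SigmaFinite μ] :
    klE μ μ = 0 := by
  have h := llr_self μ
  rw [klE, if_pos ⟨Measure.AbsolutelyContinuous.rfl, (integrable_zero _ _ _).congr h.symm⟩,
    integral_congr_ae h]
  simp

lemma gwE_uniformSphere {D E : ℕ} (hD : D ≠ 0) (hE : E ≠ 0) {ε : ℝ}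
    (hε : 32 * (D * E : ℝ) < ε) :
    gwE ε (uniformSphere D) (uniformSphere E) =
      ((4 * (D : ℝ)⁻¹ + 4 * (E : ℝ)⁻¹ : ℝ) : EReal) := by
  have := isProbabilityMeasure_uniformSphere hD
  have := isProbabilityMeasure_uniformSphere hE
  have hε0 : 0 < ε := lt_of_le_of_lt (by positivity) hε
  refine le_antisymm ?_ ?_
  · have hα : ((uniformSphere D).prod (uniformSphere E)).map Prod.fst = uniformSphere D :=
      Measure.fst_prod
    have hβ : ((uniformSphere D).prod (uniformSphere E)).map Prod.snd = uniformSphere E :=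
      Measure.snd_prod
    refine (iInf₂_le _ ⟨hα, hβ⟩).trans ?_
    rw [integral_integral_sq_sub_uniformSphere hD hE hα hβ, klE_self]
    simp [integral_prod_uniformSphere]
  · refine le_iInf₂ fun π hπ => ?_
    obtain ⟨hα, hβ⟩ := hπ
    have hprob : IsProbabilityMeasure π := by
      constructor
      rw [← Set.preimage_univ (f := Prod.fst), ← Measure.map_apply measurable_fst .univ, hα,
        measure_univ]
    rw [integral_integral_sq_sub_uniformSphere hD hE hα hβ, klE]
    split_ifs with h
    · obtain ⟨hac, hint⟩ := h
      have hkl (i : Fin D) (j : Fin E) := by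
        refine sq_integral_le_four_mul_integral_llr hac hint
          (F := fun p => p.1 i * p.2 j) (by fun_prop) ?_ (integral_prod_uniformSphere i j)
        filter_upwards [Measure.quasiMeasurePreserving_fst.ae (norm_eq_one_ae_uniformSphere D),
          Measure.quasiMeasurePreserving_snd.ae (norm_eq_one_ae_uniformSphere E)] with p hp hp'
        rw [abs_mul]
        exact mul_le_one₀ (abs_apply_le_one hp i) (abs_nonneg _) (abs_apply_le_one hp' j)
      set K := ∫ z, llr π ((uniformSphere D).prod (uniformSphere E)) z ∂π
      have hsum : ∑ k : Fin D × Fin E, (∫ p, p.1 k.1 * p.2 k.2 ∂π) ^ 2 ≤ D * E * (4 * K) := by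
        calc ∑ k : Fin D × Fin E, (∫ p, p.1 k.1 * p.2 k.2 ∂π) ^ 2
            ≤ ∑ k : Fin D × Fin E, 4 * K := Finset.sum_le_sum fun k _ => hkl k.1 k.2
          _ = D * E * (4 * K) := by simp
      have hK : 0 ≤ K := by
        have := hkl ⟨0, Nat.pos_of_ne_zero hD⟩ ⟨0, Nat.pos_of_ne_zero hE⟩
        linarith [sq_nonneg (∫ p, p.1 ⟨0, Nat.pos_of_ne_zero hD⟩ *
          p.2 ⟨0, Nat.pos_of_ne_zero hE⟩ ∂π)]
      have := mul_le_mul_of_nonneg_right hε.le hK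
      rw [← EReal.coe_mul, ← EReal.coe_add, EReal.coe_le_coe_iff]
      linarith
    · rw [EReal.coe_mul_top_of_pos hε0, EReal.coe_add_top]
      exact le_top

lemma integral_integral_inner_sq_uniformSphere {D : ℕ} (hD : D ≠ 0) :
    ∫ x, ∫ y, (inner ℝ x y) ^ 2 ∂uniformSphere D ∂uniformSphere D = (D : ℝ)⁻¹ := by
  have := isProbabilityMeasure_uniformSphere hD
  have h := norm_eq_one_ae_uniformSphere D
  have := integral_integral_sum_mul (π := uniformSphere D) (fun _ => 1)
    (f := fun (k : Fin D × Fin D) x => x k.1 * x k.2)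
    fun k => integrable_mul_of_norm_eq_one measurable_id measurable_id h h k.1 k.2
  simp only [one_mul, sum_sq_integral_apply_mul_apply_uniformSphere hD] at this
  rw [← this]
  simp only [inner_eq_sum_mul, sq, sum_mul_sum_mul]

lemma eq_of_isometric_uniformSphere {D E : ℕ} (hD : D ≠ 0) (hE : E ≠ 0)
    {I : EuclideanSpace ℝ (Fin D) → EuclideanSpace ℝ (Fin E)} (hI : Measurable I)
    (hmap : (uniformSphere D).map I = uniformSphere E)
    (hiso : ∀ᵐ p ∂(uniformSphere D).prod (uniformSphere D),
      ‖p.1 - p.2‖ ^ 2 = ‖I p.1 - I p.2‖ ^ 2) : D = E := by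
  have := isProbabilityMeasure_uniformSphere hD
  have hx := norm_eq_one_ae_uniformSphere D
  have hIx : ∀ᵐ x ∂uniformSphere D, ‖I x‖ = 1 :=
    ae_of_ae_map hI.aemeasurable (hmap ▸ norm_eq_one_ae_uniformSphere E)
  have h : ∫ x, ∫ y, (inner ℝ x y) ^ 2 ∂uniformSphere D ∂uniformSphere D =
      ∫ x, ∫ y, (inner ℝ (I x) (I y)) ^ 2 ∂uniformSphere D ∂uniformSphere D := by
    refine integral_congr_ae ?_
    filter_upwards [Measure.ae_ae_of_ae_prod hiso, hx, hIx] with x hiso' hx1 hIx1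
    refine integral_congr_ae ?_
    filter_upwards [hiso', hx, hIx] with y hy hy1 hIy1
    rw [norm_sub_sq_of_norm_eq_one hx1 hy1, norm_sub_sq_of_norm_eq_one hIx1 hIy1] at hy
    rw [inner_eq_sum_mul, inner_eq_sum_mul]
    congr 1
    linarith
  have h' : ∫ x, ∫ y, (inner ℝ x y) ^ 2 ∂uniformSphere E ∂uniformSphere E =
      ∫ x, ∫ y, (inner ℝ (I x) (I y)) ^ 2 ∂uniformSphere D ∂uniformSphere D := by
    have hin (x : EuclideanSpace ℝ (Fin E)) : ∫ y, (inner ℝ x y) ^ 2 ∂uniformSphere E =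
        ∫ y, (inner ℝ x (I y)) ^ 2 ∂uniformSphere D := by
      rw [← hmap, integral_map hI.aemeasurable (by fun_prop)]
    simp only [hin]
    rw [← hmap, integral_map hI.aemeasurable]
    refine (Measurable.stronglyMeasurable ?_).aestronglyMeasurable
    refine (StronglyMeasurable.integral_prod_right' (f := fun z : EuclideanSpace ℝ (Fin E) ×
      EuclideanSpace ℝ (Fin D) => (inner ℝ z.1 (I z.2)) ^ 2) ?_).measurable
    exact Measurable.stronglyMeasurable (by fun_prop)
  rw [← h', integral_integral_inner_sq_uniformSphere hD,
    integral_integral_inner_sq_uniformSphere hE, inv_inj, Nat.cast_inj] at h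
  exact h

/-- uniform measures on unit spheres of different dimensions are not
isometric, yet their Sinkhorn–Gromov–Wasserstein divergence vanishes for all large
enough temperatures. -/
theorem sgw_counterexample_spheres
    (D E : ℕ) (hD : 2 ≤ D) (hE : 2 ≤ E) (hDE : D ≠ E) :
    (¬ ∃ I : EuclideanSpace ℝ (Fin D) → EuclideanSpace ℝ (Fin E),
        Measurable I ∧ (uniformSphere D).map I = uniformSphere E ∧
        ∀ᵐ p ∂((uniformSphere D).prod (uniformSphere D)),
          ‖p.1 - p.2‖ ^ 2 = ‖I p.1 - I p.2‖ ^ 2) ∧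
      ∃ ε₀ : ℝ, 0 < ε₀ ∧ ∀ ε : ℝ, ε₀ < ε →
        gwE ε (uniformSphere D) (uniformSphere E)
          - (((1 : ℝ) / 2 : ℝ) : EReal) *
            (gwE ε (uniformSphere D) (uniformSphere D)
              + gwE ε (uniformSphere E) (uniformSphere E)) = 0 := by
  have hD0 : D ≠ 0 := by omega
  have hE0 : E ≠ 0 := by omega
  refine ⟨fun ⟨I, hI, hmap, hiso⟩ => hDE (eq_of_isometric_uniformSphere hD0 hE0 hI hmap hiso),
    32 * (D + E : ℝ) ^ 2, by positivity, fun ε hε => ?_⟩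
  have hDn : (0 : ℝ) ≤ D := Nat.cast_nonneg D
  have hEn : (0 : ℝ) ≤ E := Nat.cast_nonneg E
  rw [gwE_uniformSphere hD0 hE0 (by nlinarith [mul_nonneg hDn hEn]),
    gwE_uniformSphere hD0 hD0 (by nlinarith [mul_nonneg hDn hEn]),
    gwE_uniformSphere hE0 hE0 (by nlinarith [mul_nonneg hDn hEn]),
    ← EReal.coe_add, ← EReal.coe_mul, ← EReal.coe_sub, ← EReal.coe_zero, EReal.coe_eq_coe_iff]
  ring
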